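/- arXiv:math/0312033 — 4 statements merged into one kernel-verified Lean document; each statement's English description precedes it below -/
import Mathlib

section
/- For linearly independent lightlike vectors l1, l2 in the closed forward light cone V̄+, the causal complement of the wedge W[l1,l2] is the opposite wedge: W[l1,l2]' = W[l2,l1]. -/
noncomputable section

/-- Minkowski spacetime: ℝ⁴. -/
abbrev M4 : Type := Fin 4 → ℝ

/-- Minkowski bilinear form. -/
def mink (x y : M4) : ℝ := x 0 * y 0 - x 1 * y 1 - x 2 * y 2 - x 3 * y 3

/-- Lightlike vector. -/
def Lightlike (l : M4) : Prop := l ≠ 0 ∧ mink l l = 0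

/-- Closed forward light cone. -/
def closedForwardCone : Set M4 := {x | 0 ≤ mink x x ∧ 0 ≤ x 0}

/-- Open forward light cone. -/
def openForwardCone : Set M4 := {x | 0 < mink x x ∧ 0 < x 0}

/-- The wedge W[l₁,l₂]. -/
def wedge (l1 l2 : M4) : Set M4 :=
  {x | ∃ (α β : ℝ) (p : M4), 0 < α ∧ β < 0 ∧ mink p l1 = 0 ∧ mink p l2 = 0 ∧
      x = α • l1 + β • l2 + p}

/-- Spacelike complement of a set. -/
def scomp (S : Set M4) : Set M4 := {x | ∀ s ∈ S, mink (x - s) (x - s) < 0}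

/-- Causal complement: the interior of the spacelike complement. -/
def ccomp (S : Set M4) : Set M4 := interior (scomp S)

theorem mink_comm (x y : M4) : mink x y = mink y x := by
  simp only [mink]; ring

theorem mink_add_left (x y z : M4) : mink (x + y) z = mink x z + mink y z := by
  simp only [mink, Pi.add_apply]; ring

theorem mink_sub_left (x y z : M4) : mink (x - y) z = mink x z - mink y z := by
  simp only [mink, Pi.sub_apply]; ring

theorem mink_smul_left (a : ℝ) (x y : M4) : mink (a • x) y = a * mink x y := by
  simp only [mink, Pi.smul_apply, smul_eq_mul]; ring

theorem mink_add_right (x y z : M4) : mink x (y + z) = mink x y + mink x z := by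
  simp only [mink, Pi.add_apply]; ring

theorem mink_smul_right (a : ℝ) (x y : M4) : mink x (a • y) = a * mink x y := by
  simp only [mink, Pi.smul_apply, smul_eq_mul]; ring

theorem continuous_mink_left (y : M4) : Continuous fun x => mink x y := by
  unfold mink; fun_prop

theorem Lightlike.time_pos {l : M4} (h : Lightlike l) (hc : l ∈ closedForwardCone) :
    0 < l 0 := by
  refine lt_of_le_of_ne hc.2 fun h0 => h.1 ?_
  have hl := h.2
  simp only [mink] at hl
  rw [← h0] at hl
  ext i
  fin_cases i <;> simp only [Pi.zero_apply, Fin.zero_eta, Fin.mk_one, Fin.reduceFinMk]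
  · exact h0.symm
  all_goals exact pow_eq_zero_iff two_ne_zero |>.1 (by
    nlinarith [sq_nonneg (l 1), sq_nonneg (l 2), sq_nonneg (l 3)])

/-- Linearly independent forward lightlike vectors have positive Minkowski product. -/
theorem mink_pos_of_lightlike {l1 l2 : M4} (h1 : Lightlike l1) (h2 : Lightlike l2)
    (hc1 : l1 ∈ closedForwardCone) (hc2 : l2 ∈ closedForwardCone)
    (hli : LinearIndependent ℝ ![l1, l2]) : 0 < mink l1 l2 := by
  have p1 := h1.time_pos hc1
  have p2 := h2.time_pos hc2
  have e1 := h1.2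
  have e2 := h2.2
  have key : 2 * (l1 0 * l2 0) * mink l1 l2 = (l2 0 * l1 1 - l1 0 * l2 1) ^ 2
      + (l2 0 * l1 2 - l1 0 * l2 2) ^ 2 + (l2 0 * l1 3 - l1 0 * l2 3) ^ 2 := by
    simp only [mink] at e1 e2 ⊢
    linear_combination (l2 0) ^ 2 * e1 + (l1 0) ^ 2 * e2
  by_contra! hneg
  have hle : 2 * (l1 0 * l2 0) * mink l1 l2 ≤ 0 :=
    mul_nonpos_of_nonneg_of_nonpos (by positivity) hneg
  rw [key] at hle
  have hpar : l2 0 • l1 + (-l1 0) • l2 = 0 := by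
    ext i
    fin_cases i <;> simp only [Pi.add_apply, Pi.smul_apply, smul_eq_mul, Pi.zero_apply,
      Fin.zero_eta, Fin.mk_one, Fin.reduceFinMk]
    · ring_nf
    all_goals exact pow_eq_zero_iff two_ne_zero |>.1 (by
      nlinarith [sq_nonneg (l2 0 * l1 1 - l1 0 * l2 1), sq_nonneg (l2 0 * l1 2 - l1 0 * l2 2),
        sq_nonneg (l2 0 * l1 3 - l1 0 * l2 3)])
  exact p2.ne' (LinearIndependent.pair_iff.1 hli _ _ hpar).1

/-- A vector orthogonal to a lightlike vector is not timelike. -/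
theorem mink_self_nonpos_of_orthogonal {l p : M4} (hl : mink l l = 0) (h0 : 0 < l 0)
    (hp : mink p l = 0) : mink p p ≤ 0 := by
  have h : (l 0) ^ 2 * mink p p = -((p 1 * l 2 - p 2 * l 1) ^ 2 + (p 1 * l 3 - p 3 * l 1) ^ 2
      + (p 2 * l 3 - p 3 * l 2) ^ 2) := by
    simp only [mink] at hl hp ⊢
    linear_combination (p 0 * l 0 + p 1 * l 1 + p 2 * l 2 + p 3 * l 3) * hp
      - (p 1 ^ 2 + p 2 ^ 2 + p 3 ^ 2) * hl
  by_contra! hpos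
  have : 0 < (l 0) ^ 2 * mink p p := by positivity
  nlinarith [sq_nonneg (p 1 * l 2 - p 2 * l 1), sq_nonneg (p 1 * l 3 - p 3 * l 1),
    sq_nonneg (p 2 * l 3 - p 3 * l 2)]

theorem exists_lightlike_decomposition {l1 l2 : M4} (e1 : mink l1 l1 = 0) (e2 : mink l2 l2 = 0)
    (hc : mink l1 l2 ≠ 0) (x : M4) :
    ∃ p : M4, mink p l1 = 0 ∧ mink p l2 = 0 ∧
      x = (mink x l2 / mink l1 l2) • l1 + (mink x l1 / mink l1 l2) • l2 + p := by
  refine ⟨x - ((mink x l2 / mink l1 l2) • l1 + (mink x l1 / mink l1 l2) • l2), ?_, ?_, by simp⟩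
  · rw [mink_sub_left, mink_add_left, mink_smul_left, mink_smul_left, e1, mink_comm l2]
    field_simp
    ring
  · rw [mink_sub_left, mink_add_left, mink_smul_left, mink_smul_left, e2]
    field_simp
    ring

theorem mem_wedge_iff {l1 l2 : M4} (e1 : mink l1 l1 = 0) (e2 : mink l2 l2 = 0)
    (hc : 0 < mink l1 l2) (x : M4) : x ∈ wedge l1 l2 ↔ 0 < mink x l2 ∧ mink x l1 < 0 := by
  constructor
  · rintro ⟨α, β, p, hα, hβ, hp1, hp2, rfl⟩
    simp only [mink_add_left, mink_smul_left, e1, e2, hp1, hp2, mink_comm l2 l1]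
    constructor <;> nlinarith
  · rintro ⟨ha, hb⟩
    obtain ⟨p, hp1, hp2, hx⟩ := exists_lightlike_decomposition e1 e2 hc.ne' x
    exact ⟨_, _, p, div_pos ha hc, div_neg_of_neg_of_pos hb hc, hp1, hp2, hx⟩

theorem mink_self_neg_of_mem_wedge {l1 l2 x : M4} (e1 : mink l1 l1 = 0) (e2 : mink l2 l2 = 0)
    (h0 : 0 < l1 0) (hc : 0 < mink l1 l2) (hx : x ∈ wedge l1 l2) : mink x x < 0 := by
  obtain ⟨α, β, p, hα, hβ, hp1, hp2, rfl⟩ := hx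
  have hp := mink_self_nonpos_of_orthogonal e1 h0 hp1
  have h : mink (α • l1 + β • l2 + p) (α • l1 + β • l2 + p)
      = 2 * (α * β * mink l1 l2) + mink p p := by
    simp only [mink_add_left, mink_smul_left, mink_add_right, mink_smul_right, e1, e2, hp1, hp2,
      mink_comm l2 l1, mink_comm l1 p, mink_comm l2 p]
    ring
  have : α * β * mink l1 l2 < 0 := mul_neg_of_neg_of_pos (mul_neg_of_pos_of_neg hα hβ) hc
  linarith

/-- The spacelike complement of a wedge lies in the closed opposite wedge. -/
theorem le_of_mem_scomp_wedge {l1 l2 x : M4} (e1 : mink l1 l1 = 0) (e2 : mink l2 l2 = 0)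
    (hc : 0 < mink l1 l2) (hx : x ∈ scomp (wedge l1 l2)) : 0 ≤ mink x l1 ∧ mink x l2 ≤ 0 := by
  obtain ⟨p, hp1, hp2, h⟩ := exists_lightlike_decomposition e1 e2 hc.ne' x
  constructor
  · by_contra! hneg
    have hs := hx _ ⟨1, _, p, one_pos, div_neg_of_neg_of_pos hneg hc, hp1, hp2, rfl⟩
    have hd : x - ((1 : ℝ) • l1 + (mink x l1 / mink l1 l2) • l2 + p)
        = (mink x l2 / mink l1 l2 - 1) • l1 := by
      nth_rewrite 1 [h]
      module
    rw [hd, mink_smul_left, mink_smul_right, e1, mul_zero, mul_zero] at hs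
    exact hs.false
  · by_contra! hpos
    have hs := hx _ ⟨_, -1, p, div_pos hpos hc, neg_one_lt_zero, hp1, hp2, rfl⟩
    have hd : x - ((mink x l2 / mink l1 l2) • l1 + (-1 : ℝ) • l2 + p)
        = (mink x l1 / mink l1 l2 + 1) • l2 := by
      nth_rewrite 1 [h]
      module
    rw [hd, mink_smul_left, mink_smul_right, e2, mul_zero, mul_zero] at hs
    exact hs.false

theorem isOpen_wedge {l1 l2 : M4} (e1 : mink l1 l1 = 0) (e2 : mink l2 l2 = 0)
    (hc : 0 < mink l1 l2) : IsOpen (wedge l1 l2) := by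
  have : wedge l1 l2 = {x | 0 < mink x l2} ∩ {x | mink x l1 < 0} :=
    Set.ext (mem_wedge_iff e1 e2 hc)
  rw [this]
  exact (isOpen_lt continuous_const (continuous_mink_left l2)).inter
    (isOpen_lt (continuous_mink_left l1) continuous_const)

theorem ccomp_wedge (l1 l2 : M4)
    (h1 : Lightlike l1) (h2 : Lightlike l2)
    (hc1 : l1 ∈ closedForwardCone) (hc2 : l2 ∈ closedForwardCone)
    (hli : LinearIndependent ℝ ![l1, l2]) :
    ccomp (wedge l1 l2) = wedge l2 l1 := by
  have hc := mink_pos_of_lightlike h1 h2 hc1 hc2 hli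
  have hc' : 0 < mink l2 l1 := mink_comm l1 l2 ▸ hc
  have e1 := h1.2
  have e2 := h2.2
  apply Set.Subset.antisymm
  · intro x hx
    have hcont : Continuous fun t : ℝ => x + t • (l1 - l2) := by fun_prop
    have hnhds : ∀ᶠ t in nhds (0 : ℝ), x + t • (l1 - l2) ∈ scomp (wedge l1 l2) :=
      hcont.continuousAt.eventually_mem (by simpa using mem_interior_iff_mem_nhds.1 hx)
    obtain ⟨t, ht, htpos⟩ :=
      ((hnhds.filter_mono nhdsWithin_le_nhds).and
        (self_mem_nhdsWithin : Set.Ioi (0 : ℝ) ∈ nhdsWithin 0 (Set.Ioi 0))).exists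
    have hle := le_of_mem_scomp_wedge e1 e2 hc ht
    simp only [mink_add_left, mink_smul_left, mink_sub_left, e1, e2, mink_comm l2 l1] at hle
    have := mul_pos htpos hc
    exact (mem_wedge_iff e2 e1 hc' x).2 ⟨by linarith [hle.1], by linarith [hle.2]⟩
  · refine interior_maximal (fun x hx s hs => ?_) (isOpen_wedge e2 e1 hc')
    refine mink_self_neg_of_mem_wedge e2 e1 (h2.time_pos hc2) hc' ?_
    rw [mem_wedge_iff e2 e1 hc'] at hx ⊢
    rw [mem_wedge_iff e1 e2 hc] at hs
    rw [mink_sub_left, mink_sub_left]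
    exact ⟨by linarith [hx.1, hs.2], by linarith [hx.2, hs.1]⟩
end
end

section
/- Let l, l1, l2 be lightlike vectors in the closed forward light cone V̄+ such that {l, l1} and {l, l2} are each linearly independent, let t ≤ 0, and let Λ : M4 → M4 be any linear map with Λ l = e^{−2πt} l, Λ l1 = e^{2πt} l1, and Λ p = p for every p with ⟨p,l⟩ = ⟨p,l1⟩ = 0. Then Λ(W[l,l1] ∩ W[l,l2]) ⊆ W[l,l1] ∩ W[l,l2]. -/
noncomputable section

theorem mink_nonneg_of_lightlike {l m : M4} (hl : mink l l = 0) (hm : mink m m = 0)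
    (hl0 : 0 ≤ l 0) (hm0 : 0 ≤ m 0) : 0 ≤ mink l m := by
  simp only [mink] at *
  have hl' : l 0 ^ 2 = l 1 ^ 2 + l 2 ^ 2 + l 3 ^ 2 := by linarith
  have hm' : m 0 ^ 2 = m 1 ^ 2 + m 2 ^ 2 + m 3 ^ 2 := by linarith
  have h : (l 1 * m 1 + l 2 * m 2 + l 3 * m 3) ^ 2 ≤ (l 0 * m 0) ^ 2 := by
    rw [mul_pow, hl', hm']
    nlinarith [sq_nonneg (l 1 * m 2 - l 2 * m 1), sq_nonneg (l 1 * m 3 - l 3 * m 1),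
      sq_nonneg (l 2 * m 3 - l 3 * m 2)]
  linarith [le_of_sq_le_sq h (mul_nonneg hl0 hm0)]

theorem eq_zero_of_sum_three_sq_eq_zero {a b c : ℝ} (h : a ^ 2 + b ^ 2 + c ^ 2 = 0) :
    a = 0 ∧ b = 0 ∧ c = 0 := by
  refine ⟨?_, ?_, ?_⟩ <;> refine pow_eq_zero_iff two_ne_zero |>.1 ?_ <;>
    linarith [sq_nonneg a, sq_nonneg b, sq_nonneg c]

theorem mink_pos_of_linearIndependent {l m : M4} (hl : mink l l = 0) (hm : mink m m = 0)
    (hl0 : 0 ≤ l 0) (hm0 : 0 ≤ m 0) (hli : LinearIndependent ℝ ![l, m]) : 0 < mink l m := by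
  refine (mink_nonneg_of_lightlike hl hm hl0 hm0).lt_of_ne' fun h => ?_
  simp only [mink] at hl hm h
  have hsum : (m 0 * l 1 - l 0 * m 1) ^ 2 + (m 0 * l 2 - l 0 * m 2) ^ 2
      + (m 0 * l 3 - l 0 * m 3) ^ 2 = 0 := by
    linear_combination (-m 0 ^ 2) * hl - l 0 ^ 2 * hm + 2 * l 0 * m 0 * h
  obtain ⟨h1, h2, h3⟩ := eq_zero_of_sum_three_sq_eq_zero hsum
  have hdep : m 0 • l + (-l 0) • m = 0 := by
    ext i
    fin_cases i <;> simp <;> linarith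
  have hl00 : l 0 = 0 := neg_eq_zero.1 (LinearIndependent.pair_iff.1 hli _ _ hdep).2
  obtain ⟨hl1, hl2, hl3⟩ : l 1 = 0 ∧ l 2 = 0 ∧ l 3 = 0 :=
    eq_zero_of_sum_three_sq_eq_zero (by rw [hl00] at hl; linarith)
  have hlz : l = 0 := by
    ext i
    fin_cases i <;> assumption
  exact hli.ne_zero 0 hlz

theorem mem_wedge_iff_s4 {l m : M4} (hl : mink l l = 0) (hm : mink m m = 0)
    (hlm : 0 < mink l m) (x : M4) : x ∈ wedge l m ↔ mink x l < 0 ∧ 0 < mink x m := by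
  constructor
  · rintro ⟨α, β, p, hα, hβ, hpl, hpm, rfl⟩
    simp only [mink_add_left, mink_smul_left, hl, hm, hpl, hpm, mink_comm m l]
    constructor <;> nlinarith
  · rintro ⟨hxl, hxm⟩
    refine ⟨mink x m / mink l m, mink x l / mink l m,
      x - (mink x m / mink l m) • l - (mink x l / mink l m) • m,
      div_pos hxm hlm, div_neg_of_neg_of_pos hxl hlm, ?_, ?_, by abel⟩
    all_goals
      simp only [mink_sub_left, mink_smul_left, hl, hm, mink_comm m l]
      field_simp
      ring

theorem boost_maps_wedge_inter_into (l l1 l2 : M4)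
    (hl : Lightlike l) (h1 : Lightlike l1) (h2 : Lightlike l2)
    (hcl : l ∈ closedForwardCone) (hc1 : l1 ∈ closedForwardCone)
    (hc2 : l2 ∈ closedForwardCone)
    (hli1 : LinearIndependent ℝ ![l, l1]) (hli2 : LinearIndependent ℝ ![l, l2])
    (t : ℝ) (ht : t ≤ 0) (Λ : M4 →ₗ[ℝ] M4)
    (hΛl : Λ l = Real.exp (-(2 * Real.pi * t)) • l)
    (hΛ1 : Λ l1 = Real.exp (2 * Real.pi * t) • l1)
    (hΛp : ∀ p : M4, mink p l = 0 → mink p l1 = 0 → Λ p = p) :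
    Λ '' (wedge l l1 ∩ wedge l l2) ⊆ wedge l l1 ∩ wedge l l2 := by
  have hc := mink_pos_of_linearIndependent hl.2 h1.2 hcl.2 hc1.2 hli1
  have hc' := mink_pos_of_linearIndependent hl.2 h2.2 hcl.2 hc2.2 hli2
  have h12 := mink_nonneg_of_lightlike h1.2 h2.2 hc1.2 hc2.2
  rintro _ ⟨x, ⟨⟨α, β, p, hα, hβ, hpl, hp1, rfl⟩, hx2⟩, rfl⟩
  rw [mem_wedge_iff_s4 hl.2 h2.2 hc'] at hx2
  have hpt : Real.pi * t ≤ 0 := mul_nonpos_of_nonneg_of_nonpos Real.pi_pos.le ht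
  have ha : 1 ≤ Real.exp (-(2 * Real.pi * t)) := Real.one_le_exp (by linarith)
  have hb : Real.exp (2 * Real.pi * t) ≤ 1 := Real.exp_le_one_iff.2 (by linarith)
  have hb0 := Real.exp_pos (2 * Real.pi * t)
  have hΛx : Λ (α • l + β • l1 + p) = (α * Real.exp (-(2 * Real.pi * t))) • l
      + (β * Real.exp (2 * Real.pi * t)) • l1 + p := by
    rw [map_add, map_add, map_smul, map_smul, hΛl, hΛ1, hΛp p hpl hp1, smul_smul, smul_smul]
  rw [hΛx]
  generalize Real.exp (-(2 * Real.pi * t)) = a at *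
  generalize Real.exp (2 * Real.pi * t) = b at *
  have hβb : β * b < 0 := mul_neg_of_neg_of_pos hβ hb0
  refine ⟨⟨α * a, β * b, p, by positivity, hβb, hpl, hp1, rfl⟩, ?_⟩
  rw [mem_wedge_iff_s4 hl.2 h2.2 hc']
  simp only [mink_add_left, mink_smul_left, hl.2, hpl, mink_comm l1 l] at hx2 ⊢
  refine ⟨by nlinarith, ?_⟩
  have hα' : α * mink l l2 ≤ α * a * mink l l2 := by
    gcongr
    exact le_mul_of_one_le_right hα.le ha
  have hβ' : β * mink l1 l2 ≤ β * b * mink l1 l2 := by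
    gcongr
    nlinarith
  linarith [hx2.2]
end
end

section
/- If S ⊆ M4 is a nonempty, open and connected set, then its double spacelike complement S^{cc} = (S^c)^c is connected. -/
noncomputable section

lemma mink_sub_comm (x y : M4) : mink (x - y) (x - y) = mink (y - x) (y - x) := by
  simp only [mink, Pi.sub_apply]; ring

lemma mink_add_self (a b : M4) :
    mink (a + b) (a + b) = mink a a + 2 * mink a b + mink b b := by
  simp only [mink, Pi.add_apply]; ring

lemma mink_smul_self (c : ℝ) (a : M4) : mink (c • a) (c • a) = c ^ 2 * mink a a := by
  simp only [mink, Pi.smul_apply, smul_eq_mul]; ring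

/-- Two causal vectors with the same time orientation have nonnegative product. -/
lemma mink_nonneg_of_causal {a b : M4} (ha : 0 ≤ mink a a) (hb : 0 ≤ mink b b)
    (hab : 0 ≤ a 0 * b 0) : 0 ≤ mink a b := by
  simp only [mink] at *
  have cauchy : (a 1 * b 1 + a 2 * b 2 + a 3 * b 3) ^ 2 ≤
      (a 1 ^ 2 + a 2 ^ 2 + a 3 ^ 2) * (b 1 ^ 2 + b 2 ^ 2 + b 3 ^ 2) := by
    nlinarith [sq_nonneg (a 1 * b 2 - a 2 * b 1), sq_nonneg (a 1 * b 3 - a 3 * b 1),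
      sq_nonneg (a 2 * b 3 - a 3 * b 2)]
  have bound : (a 1 ^ 2 + a 2 ^ 2 + a 3 ^ 2) * (b 1 ^ 2 + b 2 ^ 2 + b 3 ^ 2) ≤
      a 0 ^ 2 * b 0 ^ 2 :=
    mul_le_mul (by linarith) (by linarith) (by positivity) (by positivity)
  have := le_of_sq_le_sq (a := a 1 * b 1 + a 2 * b 2 + a 3 * b 3) (b := a 0 * b 0)
    (by rw [mul_pow]; exact cauchy.trans bound) hab
  linarith

/-- The causal vectors whose time orientation is the sign of `σ`. -/
def causalCone (σ : ℝ) : Set M4 := {v | 0 ≤ mink v v ∧ 0 ≤ σ * v 0}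

/-- The timelike vectors whose time orientation is the sign of `σ`. -/
def timelikeCone (σ : ℝ) : Set M4 := {v | 0 < mink v v ∧ 0 < σ * v 0}

/-- The chronological future (`0 < σ`) or past (`σ < 0`) of a set. -/
def chronological (σ : ℝ) (S : Set M4) : Set M4 := {x | ∃ s ∈ S, x - s ∈ timelikeCone σ}

lemma timelikeCone_subset_causalCone (σ : ℝ) : timelikeCone σ ⊆ causalCone σ :=
  fun _ h => ⟨h.1.le, h.2.le⟩

lemma mul_time_nonneg {σ : ℝ} (hσ : σ ≠ 0) {a b : M4} (ha : 0 ≤ σ * a 0) (hb : 0 ≤ σ * b 0) :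
    0 ≤ a 0 * b 0 := by
  have h : 0 ≤ σ ^ 2 * (a 0 * b 0) := by nlinarith [mul_nonneg ha hb]
  exact nonneg_of_mul_nonneg_right h (by positivity)

lemma causalCone_add {σ : ℝ} (hσ : σ ≠ 0) {a b : M4} (ha : a ∈ causalCone σ)
    (hb : b ∈ causalCone σ) : a + b ∈ causalCone σ := by
  have h := mink_nonneg_of_causal ha.1 hb.1 (mul_time_nonneg hσ ha.2 hb.2)
  refine ⟨?_, ?_⟩
  · rw [mink_add_self]; linarith [ha.1, hb.1]
  · rw [Pi.add_apply, mul_add]; linarith [ha.2, hb.2]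

lemma causalCone_add_timelikeCone {σ : ℝ} (hσ : σ ≠ 0) {a b : M4} (ha : a ∈ causalCone σ)
    (hb : b ∈ timelikeCone σ) : a + b ∈ timelikeCone σ := by
  have h := mink_nonneg_of_causal ha.1 hb.1.le (mul_time_nonneg hσ ha.2 hb.2.le)
  refine ⟨?_, ?_⟩
  · rw [mink_add_self]; linarith [ha.1, hb.1]
  · rw [Pi.add_apply, mul_add]; linarith [ha.2, hb.2]

lemma causalCone_smul {σ c : ℝ} (hc : 0 ≤ c) {a : M4} (ha : a ∈ causalCone σ) :
    c • a ∈ causalCone σ := by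
  refine ⟨?_, ?_⟩
  · rw [mink_smul_self]; exact mul_nonneg (sq_nonneg c) ha.1
  · rw [Pi.smul_apply, smul_eq_mul, mul_left_comm]; exact mul_nonneg hc ha.2

lemma neg_mem_causalCone {σ : ℝ} {a : M4} (ha : a ∈ causalCone σ) : -a ∈ causalCone (-σ) := by
  refine ⟨?_, ?_⟩
  · simpa [mink] using ha.1
  · simpa using ha.2

lemma mem_causalCone_or_neg (σ : ℝ) {a : M4} (ha : 0 ≤ mink a a) :
    a ∈ causalCone σ ∨ a ∈ causalCone (-σ) := by
  rcases le_total 0 (σ * a 0) with h | h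
  · exact .inl ⟨ha, h⟩
  · exact .inr ⟨ha, by rw [neg_mul]; linarith⟩

lemma smul_single_mem_timelikeCone {σ c : ℝ} (h : 0 < σ * c) :
    c • (Pi.single 0 1 : M4) ∈ timelikeCone σ := by
  have hc : c ≠ 0 := by rintro rfl; simp at h
  refine ⟨?_, ?_⟩
  · rw [mink_smul_self]
    have : mink (Pi.single 0 1) (Pi.single 0 1) = 1 := by simp [mink]
    rw [this]; positivity
  · simpa using h

lemma isOpen_timelikeCone (σ : ℝ) : IsOpen (timelikeCone σ) := by
  have h : Continuous fun v : M4 => mink v v := by unfold mink; fun_prop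
  exact (isOpen_lt continuous_const h).inter
    (isOpen_lt continuous_const (continuous_const.mul (continuous_apply 0)))

lemma isOpen_chronological (σ : ℝ) (S : Set M4) : IsOpen (chronological σ S) := by
  have : chronological σ S = ⋃ s ∈ S, (fun x => x - s) ⁻¹' timelikeCone σ := by
    ext x; simp [chronological]
  rw [this]
  exact isOpen_biUnion fun s _ => (isOpen_timelikeCone σ).preimage (by fun_prop)

lemma chronological_of_causal {σ : ℝ} (hσ : σ ≠ 0) {S : Set M4} {x y : M4}
    (hx : x ∈ chronological σ S) (hxy : y - x ∈ causalCone σ) : y ∈ chronological σ S := by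
  obtain ⟨s, hs, h⟩ := hx
  refine ⟨s, hs, ?_⟩
  simpa using causalCone_add_timelikeCone hσ hxy h

lemma IsOpen.mem_chronological {σ : ℝ} (hσ : σ ≠ 0) {S : Set M4} (hS : IsOpen S) {s y : M4}
    (hs : s ∈ S) (hsy : y - s ∈ causalCone σ) : y ∈ chronological σ S := by
  have hc : Continuous fun ε : ℝ => s - (ε * σ) • (Pi.single 0 1 : M4) := by fun_prop
  have hev : ∀ᶠ ε in nhdsWithin (0 : ℝ) (Set.Ioi 0), s - (ε * σ) • (Pi.single 0 1 : M4) ∈ S :=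
    nhdsWithin_le_nhds (hc.continuousAt.eventually_mem (hS.mem_nhds (by simpa using hs)))
  obtain ⟨ε, hεS, hε⟩ := (hev.and self_mem_nhdsWithin).exists
  refine ⟨_, hεS, ?_⟩
  have hε' : 0 < ε := hε
  have ht : (ε * σ) • (Pi.single 0 1 : M4) ∈ timelikeCone σ :=
    smul_single_mem_timelikeCone (by rw [mul_left_comm]; exact mul_pos hε' (mul_self_pos.2 hσ))
  rw [← sub_add]
  exact causalCone_add_timelikeCone hσ hsy ht

lemma IsOpen.subset_chronological {σ : ℝ} (hσ : σ ≠ 0) {S : Set M4} (hS : IsOpen S) :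
    S ⊆ chronological σ S :=
  fun _ hs => hS.mem_chronological hσ hs (by simp [causalCone, mink])

lemma IsOpen.notMem_scomp_iff {σ : ℝ} (hσ : σ ≠ 0) {S : Set M4} (hS : IsOpen S) {x : M4} :
    x ∉ scomp S ↔ x ∈ chronological σ S ∪ chronological (-σ) S := by
  constructor
  · intro h
    simp only [scomp, Set.mem_ofPred_eq, not_forall, not_lt] at h
    obtain ⟨s, hs, h⟩ := h
    exact (mem_causalCone_or_neg σ h).imp (hS.mem_chronological hσ hs)
      (hS.mem_chronological (neg_ne_zero.2 hσ) hs)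
  · rintro (⟨s, hs, h⟩ | ⟨s, hs, h⟩) hx
    · exact (hx s hs).not_gt h.1
    · exact (hx s hs).not_gt h.1

lemma IsOpen.mem_scomp_scomp_iff {σ : ℝ} (hσ : σ ≠ 0) {S : Set M4} (hS : IsOpen S) {x : M4} :
    x ∈ scomp (scomp S) ↔
      ∀ y, 0 ≤ mink (y - x) (y - x) → y ∈ chronological σ S ∪ chronological (-σ) S := by
  constructor
  · intro hx y hy
    rw [← hS.notMem_scomp_iff hσ]
    intro h
    exact (hx y h).not_ge (by rwa [mink_sub_comm])
  · intro h y hy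
    by_contra! hlt
    rw [mink_sub_comm] at hlt
    exact (hS.notMem_scomp_iff hσ).2 (h y hlt) hy

lemma IsOpen.chronological_inter_subset {σ : ℝ} (hσ : σ ≠ 0) {S : Set M4} (hS : IsOpen S) :
    chronological σ S ∩ chronological (-σ) S ⊆ scomp (scomp S) := by
  rintro x ⟨hx, hx'⟩
  rw [hS.mem_scomp_scomp_iff hσ]
  intro y hy
  exact (mem_causalCone_or_neg σ hy).imp (chronological_of_causal hσ hx)
    (chronological_of_causal (neg_ne_zero.2 hσ) hx')

lemma IsOpen.segment_subset_scomp_scomp {σ : ℝ} (hσ : σ ≠ 0) {S : Set M4} (hS : IsOpen S)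
    {x z : M4} (hx : x ∈ scomp (scomp S)) (hz : z ∈ chronological σ S)
    (hzx : x - z ∈ causalCone σ) : segment ℝ z x ⊆ scomp (scomp S) := by
  rintro w ⟨a, b, ha, hb, hab, rfl⟩
  obtain rfl : a = 1 - b := by linarith
  rw [hS.mem_scomp_scomp_iff hσ] at hx ⊢
  intro y hy
  rcases mem_causalCone_or_neg σ hy with h | h
  · refine .inl (chronological_of_causal hσ (chronological_of_causal hσ hz ?_) h)
    convert causalCone_smul hb hzx using 1
    module
  · refine hx y ?_
    have := causalCone_add (neg_ne_zero.2 hσ) h (neg_mem_causalCone (causalCone_smul ha hzx))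
    convert this.1 using 2 <;> module

/-- If a downward timelike ray stays in the chronological future of `S`, that future is
everything. -/
lemma chronological_eq_univ_of_ray {σ : ℝ} (hσ : σ * σ = 1) {S : Set M4} {x : M4}
    (h : ∀ t : ℝ, 0 ≤ t → x - (t * σ) • (Pi.single 0 1 : M4) ∈ chronological σ S) :
    chronological σ S = Set.univ := by
  have hσ0 : σ ≠ 0 := by rintro rfl; simp at hσ
  refine Set.eq_univ_of_forall fun p => ?_
  obtain ⟨v, rfl⟩ : ∃ v, p = x + v := ⟨p - x, by simp⟩
  set q := v 1 ^ 2 + v 2 ^ 2 + v 3 ^ 2 with hq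
  have hq0 : 0 ≤ q := by positivity
  set t := |σ * v 0| + q + 1
  have ht : 0 ≤ t := by positivity
  have hw : q + 1 ≤ σ * v 0 + t := by linarith [neg_abs_le (σ * v 0)]
  refine chronological_of_causal hσ0 (h t ht) ?_
  have htime : σ * (v 0 + t * σ) = σ * v 0 + t := by linear_combination t * hσ
  have hsq : (v 0 + t * σ) ^ 2 = (σ * v 0 + t) ^ 2 := by
    rw [← htime]; linear_combination -(v 0 + t * σ) ^ 2 * hσ
  have hdiff : x + v - (x - (t * σ) • (Pi.single 0 1 : M4)) =
      v + (t * σ) • (Pi.single 0 1 : M4) := by abel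
  rw [hdiff]
  refine ⟨?_, ?_⟩
  · simp [mink]
    nlinarith
  · simp [htime]
    linarith

lemma subset_scomp_scomp (S : Set M4) : S ⊆ scomp (scomp S) := by
  intro s hs y hy
  rw [mink_sub_comm]
  exact hy s hs

theorem scomp_scomp_isConnected (S : Set M4) (hne : S.Nonempty)
    (hS : IsOpen S) (hconn : IsConnected S) :
    IsConnected (scomp (scomp S)) := by
  obtain ⟨s₀, hs₀⟩ := hne
  refine ⟨⟨s₀, subset_scomp_scomp S hs₀⟩, ?_⟩
  by_cases huniv : scomp (scomp S) = Set.univ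
  · rw [huniv]; exact isPreconnected_univ
  refine isPreconnected_of_forall s₀ fun x hx => ?_
  obtain ⟨σ, hσ, hxσ⟩ : ∃ σ : ℝ, σ * σ = 1 ∧ x ∈ chronological σ S := by
    rcases (hS.mem_scomp_scomp_iff one_ne_zero).1 hx x (by simp [mink]) with h | h
    · exact ⟨1, by norm_num, h⟩
    · exact ⟨-1, by norm_num, h⟩
  have hσ0 : σ ≠ 0 := by rintro rfl; simp at hσ
  have hray : ∀ t : ℝ, 0 ≤ t → (t * σ) • (Pi.single 0 1 : M4) ∈ causalCone σ := by
    intro t ht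
    rw [mul_smul]
    exact causalCone_smul ht (timelikeCone_subset_causalCone σ
      (smul_single_mem_timelikeCone (by rw [hσ]; exact one_pos)))
  let r : ℝ → M4 := fun t => x - (t * σ) • (Pi.single 0 1 : M4)
  have hrconn : IsPreconnected (r '' Set.Ici 0) :=
    isPreconnected_Ici.image r (by fun_prop : Continuous r).continuousOn
  have hrcover : r '' Set.Ici 0 ⊆ chronological σ S ∪ chronological (-σ) S := by
    rintro _ ⟨t, ht, rfl⟩
    refine (hS.mem_scomp_scomp_iff hσ0).1 hx _ ?_
    rw [mink_sub_comm]
    simpa [r] using (hray t ht).1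
  have hmeet : (r '' Set.Ici 0 ∩ chronological (-σ) S).Nonempty := by
    by_contra hempty
    refine huniv (Set.eq_univ_of_forall fun p => (hS.mem_scomp_scomp_iff hσ0).2 fun y _ => .inl ?_)
    rw [chronological_eq_univ_of_ray (x := x) hσ]
    · trivial
    · intro t ht
      have hmem : r t ∈ r '' Set.Ici 0 := ⟨t, ht, rfl⟩
      exact (hrcover hmem).resolve_right fun h => hempty ⟨_, hmem, h⟩
  obtain ⟨_, ⟨t, ht, rfl⟩, hzσ, hz⟩ := hrconn _ _ (isOpen_chronological σ S)
    (isOpen_chronological (-σ) S) hrcover ⟨x, ⟨0, by simp, by simp [r]⟩, hxσ⟩ hmeet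
  have hseg : segment ℝ (r t) x ⊆ scomp (scomp S) :=
    hS.segment_subset_scomp_scomp hσ0 hx hzσ (by simpa [r] using hray t ht)
  have ⟨s, hs, hsz⟩ := hzσ
  have hseg' : segment ℝ s (r t) ⊆ scomp (scomp S) :=
    hS.segment_subset_scomp_scomp hσ0 (hS.chronological_inter_subset hσ0 ⟨hzσ, hz⟩)
      (hS.subset_chronological hσ0 hs) (timelikeCone_subset_causalCone σ hsz)
  refine ⟨S ∪ segment ℝ s (r t) ∪ segment ℝ (r t) x,
    Set.union_subset (Set.union_subset (subset_scomp_scomp S) hseg') hseg,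
    .inl (.inl hs₀), .inr (right_mem_segment ℝ _ _), ?_⟩
  refine IsPreconnected.union (r t) (.inr (right_mem_segment ℝ _ _)) (left_mem_segment ℝ _ _)
    ?_ (convex_segment _ _).isPreconnected
  exact hconn.isPreconnected.union s hs (left_mem_segment ℝ _ _)
    (convex_segment _ _).isPreconnected
end
end

section
/- Let H be a complex Hilbert space, κ a self-adjoint unitary operator on H, and Z = (1 + iκ)/(1 + i) the associated twist operator. Let F, G be bounded operators on H and write F± = (F ± κ F κ)/2, G± = (G ± κ G κ)/2. If F+ commutes with G+, F+ commutes with G−, F− commutes with G+, and F− G− = −G− F− (normal Bose–Fermi commutation relations), then F commutes with Z G Z*. -/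
open ContinuousLinearMap Complex

/-- Conjugation by the twist operator fixes the even part and multiplies the odd part by `-iκ`
on the right. -/
theorem twist_mul_mul_twist_star {A : Type*} [Ring A] [Algebra ℂ A] (κ G : A)
    (hκ : κ * κ = 1) :
    (((1 - I) / 2) • (1 : A) + ((1 + I) / 2) • κ) * G *
        (((1 + I) / 2) • (1 : A) + ((1 - I) / 2) • κ) =
      ((1 : ℂ) / 2) • (G + κ * G * κ) - I • (((1 : ℂ) / 2) • (G - κ * G * κ) * κ) := by
  have h : κ * G * κ * κ = κ * G := by rw [mul_assoc, hκ, mul_one]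
  simp only [add_mul, mul_add, sub_mul, smul_mul_assoc, mul_smul_comm, one_mul, mul_one, h,
    smul_add, smul_sub, smul_smul]
  match_scalars <;> ring_nf <;> simp only [I_sq] <;> ring

/-- The even part commutes with the grading operator. -/
theorem even_part_mul_grading {A : Type*} [Ring A] [Algebra ℂ A] (κ F : A) (hκ : κ * κ = 1) :
    ((1 : ℂ) / 2) • (F + κ * F * κ) * κ = κ * ((1 : ℂ) / 2) • (F + κ * F * κ) := by
  have h : κ * (κ * F * κ) = F * κ := by rw [← mul_assoc, ← mul_assoc, hκ, one_mul]
  rw [smul_mul_assoc, mul_smul_comm, add_mul, mul_add, h, mul_assoc (κ * F), hκ, mul_one, add_comm]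

/-- The odd part anticommutes with the grading operator. -/
theorem odd_part_mul_grading {A : Type*} [Ring A] [Algebra ℂ A] (κ F : A) (hκ : κ * κ = 1) :
    ((1 : ℂ) / 2) • (F - κ * F * κ) * κ = -(κ * ((1 : ℂ) / 2) • (F - κ * F * κ)) := by
  have h : κ * (κ * F * κ) = F * κ := by rw [← mul_assoc, ← mul_assoc, hκ, one_mul]
  rw [smul_mul_assoc, mul_smul_comm, sub_mul, mul_sub, h, mul_assoc (κ * F), hκ, mul_one,
    ← smul_neg, neg_sub]

/-- If the even/odd parts of `F` and `G` satisfy the normal (Bose–Fermi)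
commutation relations, then `F` commutes with the twisted operator `Z G Z*`. -/
theorem commute_of_normal_commutation_relations
    {H : Type*} [NormedAddCommGroup H] [InnerProductSpace ℂ H] [CompleteSpace H]
    (κ : H →L[ℂ] H) (hκsa : adjoint κ = κ) (hκ2 : κ * κ = 1)
    (Z : H →L[ℂ] H)
    (hZ : Z = ((1 - Complex.I) / 2) • (1 : H →L[ℂ] H) + ((1 + Complex.I) / 2) • κ)
    (F G : H →L[ℂ] H)
    (Fp Fm Gp Gm : H →L[ℂ] H)
    (hFp : Fp = ((1 : ℂ) / 2) • (F + κ * F * κ))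
    (hFm : Fm = ((1 : ℂ) / 2) • (F - κ * F * κ))
    (hGp : Gp = ((1 : ℂ) / 2) • (G + κ * G * κ))
    (hGm : Gm = ((1 : ℂ) / 2) • (G - κ * G * κ))
    (hpp : Fp * Gp = Gp * Fp)
    (hpm : Fp * Gm = Gm * Fp)
    (hmp : Fm * Gp = Gp * Fm)
    (hmm : Fm * Gm = -(Gm * Fm)) :
    F * (Z * G * adjoint Z) = (Z * G * adjoint Z) * F := by
  have hZs : adjoint Z = ((1 + I) / 2) • (1 : H →L[ℂ] H) + ((1 - I) / 2) • κ := by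
    have hκs : star κ = κ := hκsa
    rw [hZ, ← star_eq_adjoint, star_add, star_smul, star_smul, star_one, hκs]
    simp [sub_eq_add_neg]
  have hZG : Z * G * adjoint Z = Gp - I • (Gm * κ) := by
    rw [hZs, hZ, hGp, hGm]
    exact twist_mul_mul_twist_star κ G hκ2
  have hFpκ : Fp * κ = κ * Fp := by
    rw [hFp]
    exact even_part_mul_grading κ F hκ2
  have hFmκ : Fm * κ = -(κ * Fm) := by
    rw [hFm]
    exact odd_part_mul_grading κ F hκ2
  have hF : F = Fp + Fm := by
    rw [hFp, hFm]
    module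
  have hp : Fp * (Gm * κ) = Gm * κ * Fp := by
    rw [← mul_assoc, hpm, mul_assoc, hFpκ, mul_assoc]
  have hm : Fm * (Gm * κ) = Gm * κ * Fm := by
    rw [← mul_assoc, hmm, neg_mul, mul_assoc, hFmκ, mul_neg, neg_neg, mul_assoc]
  rw [hZG, hF, add_mul, mul_add, mul_sub, mul_sub, sub_mul, sub_mul, mul_smul_comm,
    mul_smul_comm, smul_mul_assoc, smul_mul_assoc, hpp, hmp, hp, hm]
end
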